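/- For every positive integer n, 2^(n−1) divides the Hankel determinant H_n(f) of the sequence f (the coefficient sequence of F_3), and H_n(f)/2^(n−1) ≡ 1 (mod 6) if n ≡ 0 or 1 (mod 4), while H_n(f)/2^(n−1) ≡ 5 (mod 6) if n ≡ 2 or 3 (mod 4). -/

import Mathlib

/-- The Hankel determinant of order `n` of the sequence `c`. -/
def hankel (c : ℕ → ℤ) (n : ℕ) : ℤ :=
  Matrix.det (Matrix.of fun i j : Fin n => c (i.1 + j.1))

/-- Half of the Laurent coefficients of `(x - 1 - x⁻¹) ^ i` modulo 3. -/
def trinom : ℕ → ℕ → ZMod 3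
  | 0, k => if k = 0 then 1 else 0
  | i + 1, 0 => -trinom i 0 - 2 * trinom i 1
  | i + 1, k + 1 => trinom i k - trinom i (k + 1) - trinom i (k + 2)

theorem trinom_of_lt {i k : ℕ} (h : i < k) : trinom i k = 0 := by
  induction i generalizing k with
  | zero => simp [trinom, h.ne']
  | succ i ih =>
    obtain ⟨k, rfl⟩ : ∃ l, k = l + 1 := ⟨k - 1, by omega⟩
    simp [trinom, ih (show i < k by omega), ih (show i < k + 1 by omega),
      ih (show i < k + 2 by omega)]

theorem trinom_self (i : ℕ) : trinom i i = 1 := by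
  induction i with
  | zero => simp [trinom]
  | succ i ih =>
    simp [trinom, ih, trinom_of_lt (show i < i + 1 by omega), trinom_of_lt (show i < i + 2 by omega)]

theorem trinom_add_three (i k : ℕ) :
    trinom (i + 3) (k + 3) = trinom i k - trinom i (k + 3) - trinom i (k + 6) := by
  have h3 : (3 : ZMod 3) = 0 := rfl
  simp only [trinom]
  linear_combination (-trinom i (k + 1) + 2 * trinom i (k + 3) - trinom i (k + 5)) * h3

theorem trinom_add_three_zero (i : ℕ) :
    trinom (i + 3) 0 = -trinom i 0 - 2 * trinom i 3 := by
  have h3 : (3 : ZMod 3) = 0 := rfl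
  simp only [trinom]
  linear_combination (2 * trinom i 0 - 2 * trinom i 2) * h3

theorem trinom_add_three_one (i : ℕ) :
    trinom (i + 3) 1 = trinom i 2 - trinom i 1 - trinom i 4 := by
  have h3 : (3 : ZMod 3) = 0 := rfl
  simp only [trinom]
  linear_combination (3 * trinom i 1 - trinom i 3) * h3

theorem trinom_add_three_two (i : ℕ) :
    trinom (i + 3) 2 = -trinom i 1 - trinom i 2 - trinom i 5 := by
  have h3 : (3 : ZMod 3) = 0 := rfl
  simp only [trinom]
  linear_combination (-trinom i 0 + 2 * trinom i 2 - trinom i 4) * h3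

theorem trinom_three_mul (n k : ℕ) :
    trinom (3 * n) (3 * k) = trinom n k ∧ trinom (3 * n) (3 * k + 1) = 0 ∧
      trinom (3 * n) (3 * k + 2) = 0 := by
  induction n generalizing k with
  | zero => simp [trinom]
  | succ n ih =>
    rw [Nat.mul_succ]
    cases k with
    | zero =>
      obtain ⟨a0, a1, a2⟩ := ih 0
      obtain ⟨b0, b1, b2⟩ := ih 1
      simp only [Nat.mul_zero, Nat.zero_add, Nat.mul_one, Nat.reduceAdd] at *
      rw [trinom_add_three_zero, trinom_add_three_one, trinom_add_three_two, a0, a1, a2, b0, b1, b2]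
      simp [trinom]
    | succ k =>
      obtain ⟨a0, a1, a2⟩ := ih k
      obtain ⟨b0, b1, b2⟩ := ih (k + 1)
      obtain ⟨c0, c1, c2⟩ := ih (k + 2)
      simp only [Nat.mul_add, Nat.mul_one, add_right_comm _ 3, Nat.reduceMul,
        trinom_add_three] at *
      simp [*, trinom]

/-- The weights diagonalizing the Hankel form of the central coefficients. -/
def trinomWeight (k : ℕ) : ZMod 3 := if k = 0 then 1 else 2 * (-1) ^ k

theorem trinomWeight_succ_succ (k : ℕ) : trinomWeight (k + 2) = -trinomWeight (k + 1) := by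
  simp [trinomWeight, pow_succ]

/-- Christoffel–Darboux identity: the defect is a boundary term. -/
theorem sum_trinom_succ (i j n : ℕ) :
    ∑ k ∈ Finset.range (n + 1), trinomWeight k * trinom (i + 1) k * trinom j k
      - ∑ k ∈ Finset.range (n + 1), trinomWeight k * trinom i k * trinom (j + 1) k
      = trinomWeight (n + 1) *
        (trinom i (n + 1) * trinom j n - trinom i n * trinom j (n + 1)) := by
  induction n with
  | zero => simp [trinom, trinomWeight]; ring
  | succ n ih =>
    rw [Finset.sum_range_succ, Finset.sum_range_succ _ (n + 1), trinomWeight_succ_succ]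
    simp only [trinom]
    linear_combination ih

theorem sum_trinom_mul_trinom {n i : ℕ} (hi : i ≤ n) (j : ℕ) :
    ∑ k ∈ Finset.range (n + 1), trinomWeight k * trinom i k * trinom j k
      = trinom (i + j) 0 := by
  induction i generalizing j with
  | zero =>
    rw [Finset.sum_eq_single 0] <;> simp +contextual [trinom, trinomWeight]
  | succ i ih =>
    have h := sum_trinom_succ i j n
    rw [trinom_of_lt (show i < n by omega), trinom_of_lt (show i < n + 1 by omega),
      ih (by omega)] at h
    rw [show i + 1 + j = i + (j + 1) by ring]
    linear_combination h

theorem prod_neg_one_pow (n : ℕ) :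
    ∏ k ∈ Finset.range n, (-1 : ℤ) ^ k = if n % 4 < 2 then 1 else -1 := by
  induction n using Nat.strong_induction_on with
  | _ n ih =>
    match n with
    | 0 | 1 | 2 | 3 => decide
    | n + 4 =>
      simp only [Finset.prod_range_succ, ih n (by omega), Nat.add_mod_right, pow_succ]
      have : ((-1 : ℤ) ^ n) ^ 4 = 1 := by rw [← pow_mul, mul_comm, pow_mul]; simp
      linear_combination (if n % 4 < 2 then 1 else -1) * this

theorem prod_trinomWeight (n : ℕ) :
    ∏ k ∈ Finset.range (n + 1), trinomWeight k
      = ((2 ^ n * if (n + 1) % 4 < 2 then 1 else -1 : ℤ) : ZMod 3) := by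
  rw [← prod_neg_one_pow, Finset.prod_range_succ', Finset.prod_range_succ']
  simp [trinomWeight, Finset.prod_mul_distrib]

theorem cast_eq_trinom {f : ℕ → ℤ} (h0 : f 0 = 1)
    (hf : ∀ n : ℕ, f (3 * n) = f n ∧ f (3 * n + 1) = - f n ∧ f (3 * n + 2) = - f n) (n : ℕ) :
    (f n : ZMod 3) = trinom n 0 := by
  induction n using Nat.strong_induction_on with
  | _ n ih =>
    rcases Nat.eq_zero_or_pos n with rfl | hn
    · simp [h0, trinom]
    have ih := ih (n / 3) (by omega)
    obtain ⟨f0, f1, f2⟩ := hf (n / 3)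
    obtain ⟨t0, t1, t2⟩ := trinom_three_mul (n / 3) 0
    simp only [Nat.mul_zero, Nat.zero_add] at t0 t1 t2
    have : n = 3 * (n / 3) ∨ n = 3 * (n / 3) + 1 ∨ n = 3 * (n / 3) + 1 + 1 := by omega
    rcases this with h | h | h
    · rw [h, f0, t0, ih]
    · rw [h, f1, trinom, t0, t1]; simp [ih]
    · rw [h, f2, trinom, trinom, trinom, t0, t1, t2]
      push_cast
      linear_combination -ih

theorem hankel_cast_zmod_three {f : ℕ → ℤ} (h0 : f 0 = 1)
    (hf : ∀ n : ℕ, f (3 * n) = f n ∧ f (3 * n + 1) = - f n ∧ f (3 * n + 2) = - f n) (n : ℕ) :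
    (hankel f (n + 1) : ZMod 3)
      = ((2 ^ n * if (n + 1) % 4 < 2 then 1 else -1 : ℤ) : ZMod 3) := by
  let A : Matrix (Fin (n + 1)) (Fin (n + 1)) (ZMod 3) := .of fun i k => trinom i k
  have hA : A.det = 1 := by
    rw [Matrix.det_of_isLowerTriangular]
    · simp [A, trinom_self]
    · intro i k hik
      exact trinom_of_lt hik
  have key : (Matrix.of fun i j : Fin (n + 1) => f (i.1 + j.1)).map (Int.castRingHom (ZMod 3))
      = A * Matrix.diagonal (fun k : Fin (n + 1) => trinomWeight k) * A.transpose := by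
    ext i j
    rw [Matrix.mul_apply]
    simp only [Matrix.mul_diagonal, Matrix.map_apply, Matrix.of_apply, Matrix.transpose_apply, A,
      eq_intCast, cast_eq_trinom h0 hf]
    rw [← sum_trinom_mul_trinom (Nat.le_of_lt_succ i.2), ← Fin.sum_univ_eq_sum_range
      (fun k => trinomWeight k * trinom i k * trinom j k)]
    exact Finset.sum_congr rfl fun k _ => by ring
  have := (Int.castRingHom (ZMod 3)).map_det (Matrix.of fun i j : Fin (n + 1) => f (i.1 + j.1))
  rw [RingHom.mapMatrix_apply, key, Matrix.det_mul, Matrix.det_mul, Matrix.det_transpose, hA,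
    Matrix.det_diagonal, Fin.prod_univ_eq_prod_range, prod_trinomWeight] at this
  simpa [hankel] using this

section Riccati
open Polynomial

theorem X_add_one_dvd_of_eval_one {P : (ZMod 2)[X]} (h : P.eval 1 = 0) : X + 1 ∣ P := by
  rw [← CharTwo.sub_eq_add, ← C_1]
  exact dvd_iff_isRoot.2 h

/-- The Riccati equation `(x + 1) y' = y² + y + 1` has no rational solution over `𝔽₂`. -/
theorem eq_zero_of_riccati {P Q : (ZMod 2)[X]}
    (h : (X + 1) * (P * derivative Q + Q * derivative P) = Q ^ 2 + Q * P + P ^ 2) : P = 0 := by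
  have hX : (X + 1 : (ZMod 2)[X]).Monic := monic_X_add_C 1
  have key : ∀ k, ∀ P Q : (ZMod 2)[X],
      (X + 1) * (P * derivative Q + Q * derivative P) = Q ^ 2 + Q * P + P ^ 2 →
        (X + 1) ^ k ∣ P := by
    intro k
    induction k with
    | zero => simp
    | succ k ih =>
      intro P Q h
      have h1 : P.eval 1 = 0 ∧ Q.eval 1 = 0 := by
        have := congrArg (eval 1) h
        simp only [eval_mul, eval_add, eval_X, eval_one, eval_pow, CharTwo.add_self_eq_zero,
          zero_mul] at this
        generalize P.eval 1 = p at *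
        generalize Q.eval 1 = q at *
        revert p q
        decide
      obtain ⟨P, rfl⟩ := X_add_one_dvd_of_eval_one h1.1
      obtain ⟨Q, rfl⟩ := X_add_one_dvd_of_eval_one h1.2
      rw [pow_succ']
      refine mul_dvd_mul_left _ (ih P Q ?_)
      refine mul_left_cancel₀ (pow_ne_zero 2 hX.ne_zero) ?_
      rw [derivative_mul, derivative_mul] at h
      simp only [derivative_add, derivative_X, derivative_one] at h
      linear_combination h - (X + 1) ^ 2 * CharTwo.add_self_eq_zero (P * Q)
  by_contra hP
  obtain ⟨k, hk⟩ := (finiteMultiplicity_of_degree_pos_of_monic (p := X + 1)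
    (by rw [show (X + 1 : (ZMod 2)[X]) = X + C 1 by simp, degree_X_add_C]; decide) hX hP)
  exact hk (key _ P Q h)

end Riccati

section Approximation
open PowerSeries

theorem two_eq_zero_zmod_two : (2 : (ZMod 2)⟦X⟧) = 0 := by
  have h : (2 : ZMod 2) = 0 := rfl
  have hC := congrArg (C (R := ZMod 2)) h
  rwa [map_ofNat, map_zero] at hC

theorem eq_zero_of_X_pow_dvd_coe {R : Type*} [CommRing R] {P : Polynomial R} {n : ℕ}
    (hP : P.natDegree < n) (h : X ^ n ∣ (P : R⟦X⟧)) : P = 0 := by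
  ext i
  rcases lt_or_ge i n with hi | hi
  · rw [← Polynomial.coeff_coe, X_pow_dvd_iff.1 h i hi, Polynomial.coeff_zero]
  · rw [Polynomial.coeff_eq_zero_of_natDegree_lt (hP.trans_le hi), Polynomial.coeff_zero]

/-- A power series solution of the Riccati equation has no good rational approximation. -/
theorem eq_zero_of_coeff_mul_eq_zero {S : (ZMod 2)⟦X⟧}
    (hS : (1 + X) * d⁄dX (ZMod 2) S = S ^ 2 + S + 1) {P : Polynomial (ZMod 2)} {m : ℕ}
    (hP : P.natDegree < m)
    (hc : ∀ i < m, coeff (m + i) ((P : (ZMod 2)⟦X⟧) * S) = 0) : P = 0 := by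
  obtain ⟨m, rfl⟩ : ∃ k, m = k + 1 := ⟨m - 1, by omega⟩
  set Q := trunc (m + 1) ((P : (ZMod 2)⟦X⟧) * S) with hQ
  have hQd : Q.natDegree < m + 1 := natDegree_trunc_lt _ _
  obtain ⟨R, hR⟩ : X ^ (2 * (m + 1)) ∣ (P : (ZMod 2)⟦X⟧) * S + (Q : (ZMod 2)⟦X⟧) := by
    rw [X_pow_dvd_iff]
    intro i hi
    rw [map_add, Polynomial.coeff_coe, hQ, coeff_trunc]
    split_ifs with h
    · exact CharTwo.add_self_eq_zero _
    · obtain ⟨k, rfl⟩ := Nat.exists_eq_add_of_le (not_lt.1 h)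
      rw [hc k (by omega), add_zero]
  have h2 : (2 : (ZMod 2)⟦X⟧) = 0 := two_eq_zero_zmod_two
  have hd : d⁄dX (ZMod 2) (X ^ (2 * (m + 1)) * R)
      = X ^ (2 * (m + 1)) * d⁄dX (ZMod 2) R := by
    rw [Derivation.leibniz, derivative_pow, Nat.cast_mul, Nat.cast_two, h2]
    simp
  have hR' := congrArg (d⁄dX (ZMod 2)) hR
  rw [hd, map_add, Derivation.leibniz, derivative_coe, derivative_coe] at hR'
  simp only [smul_eq_mul] at hR'
  refine eq_zero_of_riccati (Q := Q) (CharTwo.add_eq_zero.1 ?_)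
  apply eq_zero_of_X_pow_dvd_coe (n := 2 * (m + 1))
  · compute_degree
    have := Polynomial.natDegree_derivative_le P
    have := Polynomial.natDegree_derivative_le Q
    omega
  · set W := X ^ (2 * (m + 1)) * R with hW
    refine Dvd.intro (W * R + R * (P : (ZMod 2)⟦X⟧) +
      (1 + X) * ((P : (ZMod 2)⟦X⟧) * d⁄dX (ZMod 2) R +
        R * (Polynomial.derivative P : (ZMod 2)⟦X⟧))) ?_
    push_cast
    have hQ : (Q : (ZMod 2)⟦X⟧) = W - P * S := by linear_combination hR
    have hQ' : (Polynomial.derivative Q : (ZMod 2)⟦X⟧)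
        = X ^ (2 * (m + 1)) * d⁄dX (ZMod 2) R
          - ((P : (ZMod 2)⟦X⟧) * d⁄dX (ZMod 2) S
            + S * (Polynomial.derivative P : (ZMod 2)⟦X⟧)) := by
      linear_combination hR'
    rw [hQ, hQ', hW]
    linear_combination (P : (ZMod 2)⟦X⟧) ^ 2 * hS
      + ((1 + X) * (P : (ZMod 2)⟦X⟧) * (Polynomial.derivative P : (ZMod 2)⟦X⟧) * S
        + X ^ (2 * (m + 1)) * R * (P : (ZMod 2)⟦X⟧) * S + (P : (ZMod 2)⟦X⟧) ^ 2 * S) * h2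

/-- The differential equation satisfied by `∑ gₖ xᵏ` when `g₂ₙ₊₁ = gₙ + 1` for all `n`. -/
theorem riccati_mk {g : ℕ → ZMod 2} (hg : ∀ n, g (2 * n + 1) = g n + 1) :
    (1 + X) * d⁄dX (ZMod 2) ((1 + X) * mk g)
      = ((1 + X) * mk g) ^ 2 + (1 + X) * mk g + 1 := by
  have h2 : (2 : (ZMod 2)⟦X⟧) = 0 := two_eq_zero_zmod_two
  set G := mk g with hG
  have hsq : G ^ 2 = expand 2 two_ne_zero G := by
    have := MvPowerSeries.map_frobenius_expand 2 two_ne_zero (f := G)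
    rw [ZMod.frobenius_zmod, MvPowerSeries.map_id] at this
    exact this.symm
  have key : (1 + X) ^ 2 * (d⁄dX (ZMod 2) G + G ^ 2) = 1 := by
    have h1 : d⁄dX (ZMod 2) G + G ^ 2 = expand 2 two_ne_zero (mk 1) := by
      ext n
      rw [hsq, map_add, coeff_derivative, coeff_expand, coeff_expand, hG, coeff_mk, coeff_mk]
      rcases Nat.even_or_odd' n with ⟨k, rfl | rfl⟩
      · simp [hg, CharTwo.two_eq_zero]
        rw [add_right_comm, CharTwo.add_self_eq_zero, zero_add]
      · simp [CharTwo.two_eq_zero, CharTwo.add_self_eq_zero]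
    have h3 := congrArg (expand 2 two_ne_zero) (mk_one_mul_one_sub_eq_one (ZMod 2))
    rw [map_mul, map_sub, map_one, expand_X] at h3
    rw [h1]
    linear_combination h3 + (X + X ^ 2) * expand 2 two_ne_zero (mk 1) * h2
  rw [Derivation.leibniz]
  simp only [map_add, derivative_one, derivative_X, smul_eq_mul]
  linear_combination key - ((1 + X) ^ 2 * G ^ 2) * h2

end Approximation

/-- A kernel vector of `B` would be, up to a factor `x + 1`, the denominator of a good rational
approximation to `(1 + x) ∑ gₖ xᵏ`. -/
theorem det_ne_zero_of_doubling {g : ℕ → ZMod 2} (hg : ∀ n, g (2 * n + 1) = g n + 1) {m : ℕ}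
    {B : Matrix (Fin (m + 1)) (Fin (m + 1)) (ZMod 2)} (h0 : ∀ j, B 0 j = 1)
    (hB : ∀ (i : Fin m) j, B i.succ j = g (i.1 + j.1)) : B.det ≠ 0 := by
  intro hdet
  obtain ⟨v, hv, hBv⟩ := Matrix.exists_mulVec_eq_zero_iff.2 hdet
  have hv0 : ∑ j, v j = 0 := by simpa [Matrix.mulVec, dotProduct, h0] using congrFun hBv 0
  have hvs (i : Fin m) : ∑ j, g (i.1 + j.1) * v j = 0 := by
    simpa [Matrix.mulVec, dotProduct, hB] using congrFun hBv i.succ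
  let P : Polynomial (ZMod 2) := ∑ j, Polynomial.monomial (m - j.1) (v j)
  have hPd : P.natDegree ≤ m := Polynomial.natDegree_sum_le_of_forall_le _ _ fun j _ =>
    (Polynomial.natDegree_monomial_le _).trans (Nat.sub_le _ _)
  have hP1 : P.eval 1 = 0 := by simpa [P, Polynomial.eval_finsetSum] using hv0
  have hP0 : P ≠ 0 := by
    intro hP
    apply hv
    ext j
    have := congrArg (Polynomial.coeff · (m - j.1)) hP
    simp only [P, Polynomial.finsetSum_coeff, Polynomial.coeff_monomial,
      Polynomial.coeff_zero] at this
    rw [Finset.sum_eq_single j] at this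
    · simpa using this
    · intro b _ hb
      rw [if_neg]
      omega
    · simp
  obtain ⟨R, hR⟩ := X_add_one_dvd_of_eval_one hP1
  have hX : (Polynomial.X + 1 : Polynomial (ZMod 2)).Monic := Polynomial.monic_X_add_C 1
  have hR0 : R ≠ 0 := by rintro rfl; simp [hR] at hP0
  have hRd : R.natDegree < m := by
    rw [hR, hX.natDegree_mul' hR0, show (Polynomial.X + 1 : Polynomial (ZMod 2))
      = Polynomial.X + Polynomial.C 1 by simp, Polynomial.natDegree_X_add_C] at hPd
    omega
  refine hR0 (eq_zero_of_coeff_mul_eq_zero (riccati_mk hg) hRd fun i hi => ?_)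
  have : (R : PowerSeries (ZMod 2)) * ((1 + PowerSeries.X) * PowerSeries.mk g)
      = (P : PowerSeries (ZMod 2)) * PowerSeries.mk g := by
    rw [hR]; push_cast; ring
  rw [this, ← hvs ⟨i, hi⟩]
  have hPc : (P : PowerSeries (ZMod 2)) = ∑ j, PowerSeries.monomial (m - j.1) (v j) := by
    rw [← Polynomial.coeToPowerSeries.ringHom_apply, map_sum]
    simp only [Polynomial.coeToPowerSeries.ringHom_apply, Polynomial.coe_monomial]
  rw [hPc, Finset.sum_mul, map_sum]
  refine Finset.sum_congr rfl fun j _ => ?_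
  rw [PowerSeries.monomial_eq_C_mul_X_pow, mul_assoc, PowerSeries.coeff_C_mul,
    PowerSeries.coeff_X_pow_mul', if_pos (by omega), PowerSeries.coeff_mk, mul_comm]
  congr 2
  simp only []
  omega

theorem exists_odd_hankel {f : ℕ → ℤ} (h1 : ∀ n, f n = 1 ∨ f n = -1)
    (hf : ∀ n, f n * f (n + 1) * f (2 * n + 1) * f (2 * n + 2) = -1) (m : ℕ) :
    ∃ q, Odd q ∧ hankel f (m + 1) = 2 ^ m * q := by
  have hg (n) : ∃ g, f (n + 1) = f n + 2 * g := by
    rcases h1 n with h | h <;> rcases h1 (n + 1) with h' | h' <;> rw [h, h']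
    exacts [⟨0, rfl⟩, ⟨-1, rfl⟩, ⟨1, rfl⟩, ⟨0, rfl⟩]
  choose g hg using hg
  have hg2 (n) : (g (2 * n + 1) : ZMod 2) = g n + 1 := by
    rw [← Int.cast_one, ← Int.cast_add, ZMod.intCast_eq_intCast_iff_dvd_sub]
    have a := hg n
    have b := hg (2 * n + 1)
    have c := hf n
    rcases h1 n with h | h <;> rcases h1 (n + 1) with h' | h' <;>
      rcases h1 (2 * n + 1) with k | k <;> rcases h1 (2 * n + 2) with k' | k' <;>
      simp only [h, h', k, k'] at a b c <;> omega
  let B : Matrix (Fin (m + 1)) (Fin (m + 1)) ℤ :=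
    .of fun i j => Fin.cases (f j) (fun i => g (i + j)) i
  let d : Fin (m + 1) → ℤ := Fin.cons 1 fun _ => 2
  refine ⟨B.det, ?_, ?_⟩
  · rw [← Int.not_even_iff_odd, even_iff_two_dvd]
    intro h
    have := (ZMod.intCast_zmod_eq_zero_iff_dvd B.det 2).2 (by exact_mod_cast h)
    have hB := (Int.castRingHom (ZMod 2)).map_det B
    rw [eq_intCast, this] at hB
    refine det_ne_zero_of_doubling (g := fun n => g n) hg2 (fun j => ?_) (fun i j => ?_) hB.symm
    · rcases h1 j with h | h <;> simp [B, h]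
    · simp [B]
  · rw [hankel, Matrix.det_eq_of_forall_row_eq_smul_add_pred (B := .of fun i j => d i * B i j)
      (fun _ => 1), Matrix.det_mul_column]
    · simp [d, Fin.prod_univ_succ]
    · simp [d, B]
    · intro i j
      have := hg (i + j)
      simp only [Matrix.of_apply, Fin.val_succ, Fin.cons_succ, Fin.cases_succ, Fin.val_castSucc,
        d, B, add_right_comm _ 1]
      linear_combination this

theorem mul_mul_mul_doubling_eq_neg_one {f : ℕ → ℤ} (h1 : ∀ n, f n = 1 ∨ f n = -1)
    (hf : ∀ n : ℕ, f (3 * n) = f n ∧ f (3 * n + 1) = - f n ∧ f (3 * n + 2) = - f n) (n : ℕ) :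
    f n * f (n + 1) * f (2 * n + 1) * f (2 * n + 2) = -1 := by
  have hsq (n) : f n * f n = 1 := by rcases h1 n with h | h <;> simp [h]
  induction n using Nat.strong_induction_on with
  | _ n ih =>
    obtain ⟨f0, f1, f2⟩ := hf (n / 3)
    obtain ⟨s0, -, -⟩ := hf (n / 3 + 1)
    obtain ⟨d0, d1, d2⟩ := hf (2 * (n / 3))
    obtain ⟨e0, e1, e2⟩ := hf (2 * (n / 3) + 1)
    obtain ⟨c0, -, -⟩ := hf (2 * (n / 3) + 2)
    have : n = 3 * (n / 3) ∨ n = 3 * (n / 3) + 1 ∨ n = 3 * (n / 3) + 2 := by omega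
    generalize n / 3 = k at *
    rcases this with rfl | rfl | rfl
    · rw [show 2 * (3 * k) + 1 = 3 * (2 * k) + 1 by ring,
        show 2 * (3 * k) + 2 = 3 * (2 * k) + 2 by ring, f0, f1, d1, d2]
      linear_combination -(f (2 * k) * f (2 * k)) * hsq k - hsq (2 * k)
    · rw [show 2 * (3 * k + 1) + 1 = 3 * (2 * k + 1) by ring,
        show 2 * (3 * k + 1) + 2 = 3 * (2 * k + 1) + 1 by ring,
        show 3 * k + 1 + 1 = 3 * k + 2 by ring, f1, f2, e0, e1]
      linear_combination -(f (2 * k + 1) * f (2 * k + 1)) * hsq k - hsq (2 * k + 1)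
    · rw [show 2 * (3 * k + 2) + 1 = 3 * (2 * k + 1) + 2 by ring,
        show 2 * (3 * k + 2) + 2 = 3 * (2 * k + 2) by ring,
        show 3 * k + 2 + 1 = 3 * (k + 1) by ring, f2, s0, e2, c0]
      linear_combination ih k (by omega)

/-- Congruences modulo 6 for the normalized Hankel determinants of the
coefficient sequence of `F₃`. -/
theorem F3_hankel_mod6 (f : ℕ → ℤ)
    (h0 : f 0 = 1)
    (hf : ∀ n : ℕ, f (3 * n) = f n ∧ f (3 * n + 1) = - f n ∧ f (3 * n + 2) = - f n) :
    ∀ n : ℕ, 0 < n →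
      (2 : ℤ) ^ (n - 1) ∣ hankel f n ∧
      ((n % 4 = 0 ∨ n % 4 = 1) → hankel f n / 2 ^ (n - 1) ≡ 1 [ZMOD 6]) ∧
      ((n % 4 = 2 ∨ n % 4 = 3) → hankel f n / 2 ^ (n - 1) ≡ 5 [ZMOD 6]) := by
  have h1 (n) : f n = 1 ∨ f n = -1 := by
    induction n using Nat.strong_induction_on with
    | _ n ih =>
      rcases Nat.eq_zero_or_pos n with rfl | hn
      · exact .inl h0
      have ih := ih (n / 3) (by omega)
      obtain ⟨f0, f1, f2⟩ := hf (n / 3)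
      have : n = 3 * (n / 3) ∨ n = 3 * (n / 3) + 1 ∨ n = 3 * (n / 3) + 2 := by omega
      rcases this with h | h | h <;> rw [h] <;> omega
  intro n hn
  obtain ⟨m, rfl⟩ : ∃ m, n = m + 1 := ⟨n - 1, by omega⟩
  obtain ⟨q, hq, hH⟩ := exists_odd_hankel h1 (mul_mul_mul_doubling_eq_neg_one h1 hf) m
  have hq2 := Int.odd_iff.1 hq
  have h3 := hankel_cast_zmod_three h0 hf m
  rw [hH, Int.cast_mul, Int.cast_mul] at h3
  have h2 : ((2 ^ m : ℤ) : ZMod 3) ≠ 0 := by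
    rw [Int.cast_pow]
    exact pow_ne_zero _ (by decide)
  have hq3 := (ZMod.intCast_eq_intCast_iff_dvd_sub _ _ 3).1 (mul_left_cancel₀ h2 h3)
  rw [Nat.add_sub_cancel, hH, Int.mul_ediv_cancel_left _ (by positivity), Int.ModEq, Int.ModEq]
  refine ⟨dvd_mul_right _ _, fun h => ?_, fun h => ?_⟩
  · rw [if_pos (by omega)] at hq3
    omega
  · rw [if_neg (by omega)] at hq3
    omega
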